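/- Let E₁ ↪ E₀ be Banach spaces with continuous dense embedding and r ∈ (1,∞). Then the maximal regularity space W^{1,r}(I,E₀) ∩ L^r(I,E₁) embeds continuously into C(Ī, (E₀,E₁)_{1/r',r}), where (·,·)_{1/r',r} is real interpolation and 1/r + 1/r' = 1. -/

import Mathlib

open MeasureTheory
open scoped ENNReal

noncomputable section

/-- K-functional of the Banach couple `(E₀, E₁)`, `E₁ ↪ E₀` via `ι`. -/
def Kf {E₀ E₁ : Type*} [NormedAddCommGroup E₀] [NormedAddCommGroup E₁]
    [NormedSpace ℝ E₀] [NormedSpace ℝ E₁]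
    (ι : E₁ →L[ℝ] E₀) (t : ℝ≥0∞) (x : E₀) : ℝ≥0∞ :=
  ⨅ b : E₁, (ENNReal.ofReal ‖x - ι b‖ + t * ENNReal.ofReal ‖b‖)

/-- Norm of the real interpolation space `(E₀,E₁)_{θ,r}` (discrete K-method). -/
def realInterpNorm {E₀ E₁ : Type*} [NormedAddCommGroup E₀] [NormedAddCommGroup E₁]
    [NormedSpace ℝ E₀] [NormedSpace ℝ E₁]
    (ι : E₁ →L[ℝ] E₀) (θ r : ℝ) (x : E₀) : ℝ≥0∞ :=
  (∑' k : ℤ, (((2 : ℝ≥0∞) ^ k) ^ (-θ) * Kf ι ((2 : ℝ≥0∞) ^ k) x) ^ r) ^ (1 / r)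

section Inequalities

variable {α : Type*} [MeasurableSpace α] {μ : Measure α}

/-- Hölder's inequality against the constant `1`, without measurability assumption. -/
theorem lintegral_le_measure_rpow_mul {p q : ℝ} (hpq : q.HolderConjugate p) (f : α → ℝ≥0∞) :
    ∫⁻ a, f a ∂μ ≤ μ Set.univ ^ (1 / q) * (∫⁻ a, f a ^ p ∂μ) ^ (1 / p) := by
  obtain ⟨g, hgm, hgf, hg⟩ := exists_measurable_le_lintegral_eq μ f
  rw [hg]
  have h := ENNReal.lintegral_mul_le_Lp_mul_Lq μ hpq (f := fun _ => 1) (g := g)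
    aemeasurable_const hgm.aemeasurable
  have hp : 0 < p := hpq.symm.pos
  simp only [Pi.mul_apply, one_mul, ENNReal.one_rpow, lintegral_const] at h
  refine h.trans ?_
  gcongr
  exact hgf _

theorem rpow_mul_measure_le_lintegral {A : Set α} (hA : MeasurableSet A) {r : ℝ} (hr : 0 ≤ r)
    {X c : ℝ≥0∞} (hc : c ≠ ⊤) {g : α → ℝ≥0∞} (h : ∀ᵐ a ∂μ, a ∈ A → X ≤ c * g a) :
    X ^ r * μ A ≤ c ^ r * ∫⁻ a in A, g a ^ r ∂μ := by
  rw [← lintegral_const_mul' _ _ (ENNReal.rpow_ne_top_of_nonneg hr hc), ← setLIntegral_const]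
  refine setLIntegral_mono_ae' hA ?_
  filter_upwards [h] with a ha haA
  rw [← ENNReal.mul_rpow_of_nonneg _ _ hr]
  gcongr
  exact ha haA

/-- Discrete Hardy (Young) inequality. -/
theorem tsum_tsum_mul_rpow_le {r : ℝ} (hr : 1 ≤ r) (w a : ℕ → ℝ≥0∞) :
    ∑' n, (∑' m, w m * a (n + m)) ^ r ≤ (∑' m, w m) ^ r * ∑' n, a n ^ r := by
  have hr0 : 0 < r := by linarith
  have key (b : ℕ → ℝ≥0∞) :
      (∑' m, w m * b m) ^ r ≤ (∑' m, w m) ^ (r - 1) * ∑' m, w m * b m ^ r := by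
    have h : ∑' m, w m * b m ≤ (∑' m, w m) ^ (1 - r⁻¹) * (∑' m, w m * b m ^ r) ^ r⁻¹ := by
      rw [ENNReal.tsum_eq_iSup_sum]
      refine iSup_le fun s => (ENNReal.inner_le_weight_mul_Lp_of_nonneg s hr w b).trans ?_
      have : 0 ≤ 1 - r⁻¹ := by
        have := inv_le_one_of_one_le₀ hr
        linarith
      gcongr <;> exact ENNReal.sum_le_tsum s
    calc (∑' m, w m * b m) ^ r
        ≤ ((∑' m, w m) ^ (1 - r⁻¹) * (∑' m, w m * b m ^ r) ^ r⁻¹) ^ r := by gcongr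
      _ = _ := by
        rw [ENNReal.mul_rpow_of_nonneg _ _ hr0.le, ← ENNReal.rpow_mul, ← ENNReal.rpow_mul,
          inv_mul_cancel₀ hr0.ne', ENNReal.rpow_one, sub_mul, inv_mul_cancel₀ hr0.ne', one_mul]
  calc ∑' n, (∑' m, w m * a (n + m)) ^ r
      ≤ ∑' n, (∑' m, w m) ^ (r - 1) * ∑' m, w m * a (n + m) ^ r :=
        ENNReal.tsum_le_tsum fun n => key fun m => a (n + m)
    _ = (∑' m, w m) ^ (r - 1) * ∑' m, w m * ∑' n, a (n + m) ^ r := by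
        rw [ENNReal.tsum_mul_left, ENNReal.tsum_comm]
        simp_rw [ENNReal.tsum_mul_left]
    _ ≤ (∑' m, w m) ^ (r - 1) * ∑' m, w m * ∑' n, a n ^ r := by
        gcongr _ * ∑' m, _ * ?_ with m
        exact ENNReal.tsum_comp_le_tsum_of_injective (add_left_injective m) fun n => a n ^ r
    _ = (∑' m, w m) ^ r * ∑' n, a n ^ r := by
        rw [ENNReal.tsum_mul_right, ← mul_assoc]
        congr 1
        nth_rw 2 [← ENNReal.rpow_one (∑' m, w m)]
        rw [← ENNReal.rpow_add_of_nonneg _ _ (by linarith) zero_le_one, sub_add_cancel]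

end Inequalities

section KFunctional

variable {E₀ E₁ : Type*} [NormedAddCommGroup E₀] [NormedAddCommGroup E₁]
  [NormedSpace ℝ E₀] [NormedSpace ℝ E₁] (ι : E₁ →L[ℝ] E₀)

theorem Kf_le_add (t : ℝ≥0∞) (x : E₀) (b : E₁) : Kf ι t x ≤ ‖x - ι b‖ₑ + t * ‖b‖ₑ := by
  simp_rw [Kf, ofReal_norm]
  exact iInf_le (fun b : E₁ => ‖x - ι b‖ₑ + t * ‖b‖ₑ) b

theorem Kf_le_enorm (t : ℝ≥0∞) (x : E₀) : Kf ι t x ≤ ‖x‖ₑ := by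
  simpa using Kf_le_add ι t x 0

theorem Kf_sub_le (t : ℝ≥0∞) (x y : E₀) : Kf ι t (x - y) ≤ Kf ι t x + Kf ι t y := by
  rw [Kf.eq_def ι t x, Kf.eq_def ι t y, ENNReal.iInf_add]
  refine le_iInf fun b => ?_
  rw [ENNReal.add_iInf]
  refine le_iInf fun c => (Kf_le_add ι t (x - y) (b - c)).trans ?_
  simp_rw [ofReal_norm]
  have h₁ : ‖x - y - ι (b - c)‖ₑ ≤ ‖x - ι b‖ₑ + ‖y - ι c‖ₑ := by
    rw [map_sub, sub_sub_sub_comm]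
    exact enorm_sub_le
  calc _ ≤ ‖x - ι b‖ₑ + ‖y - ι c‖ₑ + t * (‖b‖ₑ + ‖c‖ₑ) := by
        gcongr
        exact enorm_sub_le
    _ = _ := by ring

/-- The `k`-th term of the series defining the `r`-th power of the interpolation norm. -/
def interpTerm (θ r : ℝ) (x : E₀) (k : ℤ) : ℝ≥0∞ :=
  (((2 : ℝ≥0∞) ^ k) ^ (-θ) * Kf ι ((2 : ℝ≥0∞) ^ k) x) ^ r

theorem interpTerm_sub_le {r : ℝ} (hr : 1 ≤ r) (θ : ℝ) (x y : E₀) (k : ℤ) :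
    interpTerm ι θ r (x - y) k ≤
      2 ^ (r - 1) * (interpTerm ι θ r x k + interpTerm ι θ r y k) := by
  refine le_trans ?_ (ENNReal.rpow_add_le_mul_rpow_add_rpow _ _ hr)
  rw [← mul_add, interpTerm]
  gcongr
  exact Kf_sub_le ι _ x y

theorem tsum_int_split (f : ℤ → ℝ≥0∞) (k : ℤ) :
    ∑' j, f j = ∑' n : ℕ, f (k + n) + ∑' n : ℕ, f (k - (n + 1)) := by
  rw [← (Equiv.addLeft k).tsum_eq f]
  have h := (HasSum.of_nat_of_neg_add_one (f := fun j => f (Equiv.addLeft k j))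
    ENNReal.summable.hasSum ENNReal.summable.hasSum).tsum_eq
  rw [h]
  rfl

theorem realInterpNorm_rpow {r : ℝ} (hr : 0 < r) (θ : ℝ) (x : E₀) (k : ℤ) :
    realInterpNorm ι θ r x ^ r =
      ∑' n : ℕ, interpTerm ι θ r x (k + n) + ∑' n : ℕ, interpTerm ι θ r x (k - (n + 1)) := by
  rw [← tsum_int_split, realInterpNorm, ← ENNReal.rpow_mul, one_div_mul_cancel hr.ne',
    ENNReal.rpow_one]
  rfl

/-- The sum over the scales `2 ^ j`, `j ≥ k`, is controlled by the norm of `E₀`. -/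
theorem exists_tsum_interpTerm_le {r θ : ℝ} (hr : 0 < r) (hθ : 0 < θ) (k : ℤ) :
    ∃ C : ℝ≥0∞, C < ⊤ ∧ ∀ x : E₀, ∑' n : ℕ, interpTerm ι θ r x (k + n) ≤ C * ‖x‖ₑ ^ r := by
  refine ⟨∑' n : ℕ, (((2 : ℝ≥0∞) ^ k) ^ (-θ)) ^ r * ((2 : ℝ≥0∞) ^ (-θ * r)) ^ n, ?_,
    fun x => ?_⟩
  · rw [ENNReal.tsum_mul_left, ENNReal.tsum_geometric]
    refine ENNReal.mul_lt_top ?_ ?_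
    · refine ENNReal.rpow_lt_top_of_nonneg hr.le (ENNReal.rpow_ne_top_of_ne_zero ?_ ?_)
      · exact (ENNReal.zpow_pos (by simp) (by simp) k).ne'
      · exact (ENNReal.zpow_lt_top (by simp) (by simp) k).ne
    · rw [ENNReal.inv_lt_top, tsub_pos_iff_lt]
      exact ENNReal.rpow_lt_one_of_one_lt_of_neg (by norm_num) (by nlinarith)
  · rw [← ENNReal.tsum_mul_right]
    gcongr with n
    rw [interpTerm, ENNReal.mul_rpow_of_nonneg _ _ hr.le]
    gcongr
    · rw [ENNReal.zpow_add (by simp) (by simp), zpow_natCast, ENNReal.mul_rpow_of_ne_top,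
        ENNReal.mul_rpow_of_nonneg _ _ hr.le]
      · simp_rw [← ENNReal.rpow_natCast, ← ENNReal.rpow_mul]
        apply le_of_eq
        congr 2
        ring
      · exact (ENNReal.zpow_lt_top (by simp) (by simp) k).ne
      · simp
    · exact Kf_le_enorm ι _ x

end KFunctional
section Trace

variable {E₀ E₁ : Type*} [NormedAddCommGroup E₀] [NormedAddCommGroup E₁]
  [NormedSpace ℝ E₀] [NormedSpace ℝ E₁] (ι : E₁ →L[ℝ] E₀)

/-- The dyadic annulus of radii `2 ^ j` and `2 ^ (j + 1)` around `t`. -/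
def dyadicAnnulus (t : ℝ) (j : ℤ) : Set ℝ :=
  {s | (2 : ℝ) ^ j < |s - t| ∧ |s - t| ≤ (2 : ℝ) ^ (j + 1)}

theorem measurableSet_dyadicAnnulus (t : ℝ) (j : ℤ) : MeasurableSet (dyadicAnnulus t j) := by
  unfold dyadicAnnulus
  measurability

theorem ofReal_two_zpow (j : ℤ) : ENNReal.ofReal ((2 : ℝ) ^ j) = (2 : ℝ≥0∞) ^ j := by
  rw [← Real.rpow_intCast, ← ENNReal.rpow_intCast, ← ENNReal.ofReal_rpow_of_pos two_pos]
  simp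

theorem volume_dyadicAnnulus_le (t : ℝ) (j : ℤ) :
    volume (dyadicAnnulus t j) ≤ 4 * (2 : ℝ≥0∞) ^ j := by
  have h : dyadicAnnulus t j ⊆ Metric.closedBall t ((2 : ℝ) ^ (j + 1)) := fun s hs => by
    simpa [Real.dist_eq] using hs.2
  refine (measure_mono h).trans ?_
  rw [Real.volume_closedBall, ← ofReal_two_zpow, zpow_add₀ two_ne_zero, zpow_one,
    ← ENNReal.ofReal_ofNat, ← ENNReal.ofReal_mul (by norm_num)]
  exact ENNReal.ofReal_le_ofReal (by linarith)

theorem le_volume_restrict_dyadicAnnulus {T t : ℝ} (ht : t ∈ Set.Icc 0 T) {j : ℤ}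
    (hj : (2 : ℝ) ^ (j + 1) < T / 2) :
    (2 : ℝ≥0∞) ^ j ≤ volume.restrict (Set.Ioo 0 T) (dyadicAnnulus t j) := by
  rw [Measure.restrict_apply (measurableSet_dyadicAnnulus t j), ← ofReal_two_zpow]
  have h0 : (0 : ℝ) < 2 ^ j := by positivity
  have h1 : (2 : ℝ) ^ (j + 1) = 2 ^ j + 2 ^ j := by
    rw [zpow_add₀ two_ne_zero, zpow_one, mul_two]
  rcases le_total t (T / 2) with h | h
  · have hsub : Set.Ioc (t + 2 ^ j) (t + 2 ^ (j + 1)) ⊆ dyadicAnnulus t j ∩ Set.Ioo 0 T := by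
      intro s hs
      have := ht.1
      have hs1 := hs.1
      have hs2 := hs.2
      refine ⟨?_, by linarith, by linarith⟩
      rw [dyadicAnnulus, Set.mem_ofPred_eq, abs_of_pos (by linarith)]
      constructor <;> linarith
    refine le_trans ?_ (measure_mono hsub)
    rw [Real.volume_Ioc]
    exact ENNReal.ofReal_le_ofReal (by linarith)
  · have hsub : Set.Ico (t - 2 ^ (j + 1)) (t - 2 ^ j) ⊆ dyadicAnnulus t j ∩ Set.Ioo 0 T := by
      intro s hs
      have := ht.2
      have hs1 := hs.1
      have hs2 := hs.2
      refine ⟨?_, by linarith, by linarith⟩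
      rw [dyadicAnnulus, Set.mem_ofPred_eq, abs_of_neg (by linarith)]
      constructor <;> linarith
    refine le_trans ?_ (measure_mono hsub)
    rw [Real.volume_Ico]
    exact ENNReal.ofReal_le_ofReal (by linarith)

theorem pairwise_disjoint_dyadicAnnulus (t : ℝ) (k : ℤ) :
    Pairwise (Function.onFun Disjoint fun n : ℕ => dyadicAnnulus t (k - (n + 1))) := by
  refine (pairwise_disjoint_on _).2 fun m n hmn => Set.disjoint_left.2 fun s hm hn => ?_
  have : (2 : ℝ) ^ (k - (n + 1 : ℤ) + 1) ≤ 2 ^ (k - (m + 1 : ℤ)) :=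
    zpow_le_zpow_right₀ one_le_two (by lia)
  linarith [hm.1, hn.2]

theorem exists_mem_dyadicAnnulus {t s : ℝ} (hst : s ≠ t) {k : ℤ} (h : |s - t| ≤ (2 : ℝ) ^ k) :
    ∃ n : ℕ, s ∈ dyadicAnnulus t (k - (n + 1)) := by
  obtain ⟨j, hj⟩ := exists_mem_Ioc_zpow (abs_pos.2 (sub_ne_zero.2 hst)) (one_lt_two (α := ℝ))
  have hjk : j < k := (zpow_lt_zpow_iff_right₀ (one_lt_two (α := ℝ))).1 (hj.1.trans_le h)
  obtain ⟨n, hn⟩ := Int.le.dest (show j + 1 ≤ k by lia)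
  refine ⟨n, ?_⟩
  rw [show k - (n + 1 : ℤ) = j by lia]
  exact hj

theorem tsum_lintegral_dyadicAnnulus_le (μ : Measure ℝ) (t : ℝ) (k : ℤ) (f : ℝ → ℝ≥0∞) :
    ∑' n : ℕ, ∫⁻ s in dyadicAnnulus t (k - (n + 1)), f s ∂μ ≤
      ∫⁻ s in Metric.closedBall t (2 ^ k), f s ∂μ := by
  rw [← lintegral_iUnion (fun n => measurableSet_dyadicAnnulus t _)
    (pairwise_disjoint_dyadicAnnulus t k)]
  refine lintegral_mono_set (Set.iUnion_subset fun n s hs => ?_)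
  rw [Metric.mem_closedBall, Real.dist_eq]
  exact hs.2.trans (zpow_le_zpow_right₀ one_le_two (by lia))

theorem lintegral_closedBall_le_tsum (μ : Measure ℝ) [NullSingletonClass μ] (t : ℝ) (k : ℤ)
    (f : ℝ → ℝ≥0∞) :
    ∫⁻ s in Metric.closedBall t (2 ^ k), f s ∂μ ≤
      ∑' n : ℕ, ∫⁻ s in dyadicAnnulus t (k - (n + 1)), f s ∂μ := by
  refine le_trans ?_ (lintegral_iUnion_le _ _)
  calc _ ≤ ∫⁻ s in {t} ∪ ⋃ n : ℕ, dyadicAnnulus t (k - (n + 1)), f s ∂μ := by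
        refine lintegral_mono_set fun s hs => ?_
        by_cases h : s = t
        · exact Or.inl h
        · exact Or.inr (Set.mem_iUnion.2 (exists_mem_dyadicAnnulus h (by
            simpa [Real.dist_eq] using hs)))
    _ ≤ _ := by
        refine (lintegral_union_le _ _ _).trans ?_
        simp

theorem exists_tsum_interpTerm_le_lintegral {r r' : ℝ} (hr : r'.HolderConjugate r) :
    ∃ C : ℝ≥0∞, C < ⊤ ∧ ∀ (T t : ℝ), t ∈ Set.Icc 0 T → ∀ k : ℤ, (2 : ℝ) ^ k < T / 2 →
      ∀ (x : E₀) (v : ℝ → E₁) (f : ℝ → ℝ≥0∞),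
        (∀ s ∈ Set.Ioo 0 T, ‖x - ι (v s)‖ₑ ≤
          ∫⁻ σ in Metric.closedBall t |s - t|, f σ ∂(volume.restrict (Set.Ioo 0 T))) →
        ∑' n : ℕ, interpTerm ι (1 / r') r x (k - (n + 1)) ≤
          C * (∫⁻ σ in Metric.closedBall t (2 ^ k), f σ ^ r ∂(volume.restrict (Set.Ioo 0 T)) +
            ∫⁻ σ in Metric.closedBall t (2 ^ k), ‖v σ‖ₑ ^ r
              ∂(volume.restrict (Set.Ioo 0 T))) := by
  have hr1 : 1 < r := hr.symm.lt
  have hr0 : 0 < r := hr.symm.pos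
  have hr0' : 0 < r' := hr.pos
  have hθ : 0 < 1 / r' := by positivity
  have hθr : 1 / r' * r = r - 1 := by
    have := hr.symm.one_sub_inv
    rw [one_div, ← this]
    field_simp
  set w : ℕ → ℝ≥0∞ := fun m => 4 ^ (1 / r') * ((2 : ℝ≥0∞) ^ (-(1 / r'))) ^ m with hw
  have hwfin : ∑' m, w m < ⊤ := by
    rw [hw, ENNReal.tsum_mul_left, ENNReal.tsum_geometric]
    refine ENNReal.mul_lt_top (ENNReal.rpow_lt_top_of_nonneg hθ.le (by simp)) ?_
    rw [ENNReal.inv_lt_top, tsub_pos_iff_lt]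
    exact ENNReal.rpow_lt_one_of_one_lt_of_neg (by norm_num) (by linarith)
  refine ⟨2 ^ (r - 1) * ((∑' m, w m) ^ r + 1), ?_, ?_⟩
  · refine ENNReal.mul_lt_top (ENNReal.rpow_lt_top_of_nonneg (by linarith) (by simp)) ?_
    exact ENNReal.add_lt_top.2 ⟨ENNReal.rpow_lt_top_of_nonneg hr0.le hwfin.ne, by simp⟩
  intro T t ht k hk x v f hf
  set μ := volume.restrict (Set.Ioo 0 T) with hμ
  set A : ℕ → Set ℝ := fun n => dyadicAnnulus t (k - (n + 1)) with hA
  set h : ℕ → ℝ≥0∞ := fun n => (2 : ℝ≥0∞) ^ (k - (n + 1 : ℤ)) with hh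
  have hh0 (n) : h n ≠ 0 := (ENNReal.zpow_pos (by simp) (by simp) _).ne'
  have hht (n) : h n ≠ ⊤ := (ENNReal.zpow_lt_top (by simp) (by simp) _).ne
  set c : ℕ → ℝ≥0∞ := fun n => ∫⁻ s in A n, f s ^ r ∂μ
  set d : ℕ → ℝ≥0∞ := fun n => ∫⁻ s in A n, ‖v s‖ₑ ^ r ∂μ
  set P : ℕ → ℝ≥0∞ := fun n => ∑' m, ∫⁻ s in A (n + m), f s ∂μ with hP
  have hAP (n m : ℕ) : h n ^ (-(1 / r')) * ∫⁻ s in A (n + m), f s ∂μ ≤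
      w m * c (n + m) ^ (1 / r) := by
    have hmeas : μ (A (n + m)) ≤ 4 * (h n * (2 ^ m)⁻¹) := by
      refine (Measure.restrict_apply_le _ _).trans ((volume_dyadicAnnulus_le t _).trans ?_)
      gcongr
      rw [hh, ← zpow_natCast, ← ENNReal.zpow_neg, ← ENNReal.zpow_add (by simp) (by simp)]
      apply le_of_eq
      congr 1
      push_cast
      ring
    calc h n ^ (-(1 / r')) * ∫⁻ s in A (n + m), f s ∂μ
        ≤ h n ^ (-(1 / r')) * ((4 * (h n * (2 ^ m)⁻¹)) ^ (1 / r') * c (n + m) ^ (1 / r)) := by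
          gcongr
          refine (lintegral_le_measure_rpow_mul hr _).trans ?_
          rw [Measure.restrict_apply_univ]
          gcongr
      _ = (h n ^ (-(1 / r')) * h n ^ (1 / r')) * (4 ^ (1 / r') * ((2 ^ m)⁻¹) ^ (1 / r')) *
            c (n + m) ^ (1 / r) := by
          rw [ENNReal.mul_rpow_of_nonneg _ _ hθ.le, ENNReal.mul_rpow_of_nonneg _ _ hθ.le]
          ring
      _ = w m * c (n + m) ^ (1 / r) := by
          rw [← ENNReal.rpow_add _ _ (hh0 n) (hht n), neg_add_cancel, ENNReal.rpow_zero, one_mul,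
            hw, ENNReal.inv_rpow, ← ENNReal.rpow_neg]
          simp_rw [← ENNReal.rpow_natCast, ← ENNReal.rpow_mul]
          congr 3
          ring
  have hterm (n : ℕ) : interpTerm ι (1 / r') r x (k - (n + 1)) ≤
      2 ^ (r - 1) * ((∑' m, w m * c (n + m) ^ (1 / r)) ^ r + d n) := by
    set K := Kf ι (h n) x with hK
    have hKle : ∀ᵐ s ∂μ, s ∈ A n → K - P n ≤ h n * ‖v s‖ₑ := by
      filter_upwards [ae_restrict_mem measurableSet_Ioo] with s hs hsA
      rw [tsub_le_iff_left]
      refine (Kf_le_add ι _ x (v s)).trans ?_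
      gcongr
      refine (hf s hs).trans ?_
      calc _ ≤ ∫⁻ σ in Metric.closedBall t (2 ^ (k - n)), f σ ∂μ := by
            refine lintegral_mono_set (Metric.closedBall_subset_closedBall ?_)
            have := hsA.2
            rwa [show k - (n + 1 : ℤ) + 1 = k - n by ring] at this
        _ ≤ _ := by
            refine (lintegral_closedBall_le_tsum μ t (k - n) f).trans_eq ?_
            rw [hP, hA]
            congr! 5
            push_cast
            ring
    have hX := rpow_mul_measure_le_lintegral (measurableSet_dyadicAnnulus t _) hr0.le (hht n) hKle
    have hd : (h n ^ (-(1 / r')) * (K - P n)) ^ r ≤ d n := by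
      have hmeas : h n ≤ μ (A n) := le_volume_restrict_dyadicAnnulus ht <|
        (zpow_le_zpow_right₀ one_le_two (by lia)).trans_lt hk
      have h1 : (K - P n) ^ r * h n ≤ h n ^ r * d n := (by gcongr : _ ≤ _).trans hX
      calc (h n ^ (-(1 / r')) * (K - P n)) ^ r
          = h n ^ (-r) * ((K - P n) ^ r * h n) := by
            rw [ENNReal.mul_rpow_of_nonneg _ _ hr0.le, ← ENNReal.rpow_mul, neg_mul, hθr, neg_sub,
              sub_eq_neg_add, ENNReal.rpow_add _ _ (hh0 n) (hht n), ENNReal.rpow_one]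
            ring
        _ ≤ h n ^ (-r) * (h n ^ r * d n) := by gcongr
        _ = d n := by
            rw [← mul_assoc, ← ENNReal.rpow_add _ _ (hh0 n) (hht n), neg_add_cancel,
              ENNReal.rpow_zero, one_mul]
    calc interpTerm ι (1 / r') r x (k - (n + 1))
        ≤ (h n ^ (-(1 / r')) * P n + h n ^ (-(1 / r')) * (K - P n)) ^ r := by
          rw [interpTerm, ← mul_add]
          gcongr
          exact le_add_tsub
      _ ≤ 2 ^ (r - 1) * ((h n ^ (-(1 / r')) * P n) ^ r + (h n ^ (-(1 / r')) * (K - P n)) ^ r) :=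
          ENNReal.rpow_add_le_mul_rpow_add_rpow _ _ hr1.le
      _ ≤ _ := by
          gcongr
          rw [hP, ← ENNReal.tsum_mul_left]
          exact ENNReal.tsum_le_tsum (hAP n)
  calc ∑' n : ℕ, interpTerm ι (1 / r') r x (k - (n + 1))
      ≤ ∑' n, 2 ^ (r - 1) * ((∑' m, w m * c (n + m) ^ (1 / r)) ^ r + d n) :=
        ENNReal.tsum_le_tsum hterm
    _ = 2 ^ (r - 1) * (∑' n, (∑' m, w m * c (n + m) ^ (1 / r)) ^ r + ∑' n, d n) := by
        rw [ENNReal.tsum_mul_left, ENNReal.tsum_add]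
    _ ≤ 2 ^ (r - 1) * ((∑' m, w m) ^ r * ∑' n, c n + ∑' n, d n) := by
        gcongr
        refine (tsum_tsum_mul_rpow_le hr1.le w fun n => c n ^ (1 / r)).trans_eq ?_
        simp_rw [← ENNReal.rpow_mul, one_div_mul_cancel hr0.ne', ENNReal.rpow_one]
    _ ≤ 2 ^ (r - 1) * (((∑' m, w m) ^ r + 1) * ∑' n, c n + ((∑' m, w m) ^ r + 1) * ∑' n, d n) := by
        gcongr
        · exact le_self_add
        · exact le_mul_of_one_le_left' le_add_self
    _ = 2 ^ (r - 1) * ((∑' m, w m) ^ r + 1) * (∑' n, c n + ∑' n, d n) := by ring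
    _ ≤ _ := by
        gcongr <;> exact tsum_lintegral_dyadicAnnulus_le μ t k _

end Trace
section MaximalRegularity

variable {E₀ E₁ : Type*} [NormedAddCommGroup E₀] [NormedAddCommGroup E₁]
  [NormedSpace ℝ E₀] [NormedSpace ℝ E₁] (ι : E₁ →L[ℝ] E₀)

theorem exists_enorm_rpow_le_lintegral {α : Type*} [MeasurableSpace α] (μ : Measure α)
    [IsFiniteMeasure μ] (hμ : μ ≠ 0) {r r' : ℝ} (hr : r'.HolderConjugate r) :
    ∃ C : ℝ≥0∞, C < ⊤ ∧ ∀ (x : E₀) (v : α → E₁) (f : α → ℝ≥0∞),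
      (∀ᵐ s ∂μ, ‖x - ι (v s)‖ₑ ≤ ∫⁻ σ, f σ ∂μ) →
        ‖x‖ₑ ^ r ≤ C * (∫⁻ σ, f σ ^ r ∂μ + ∫⁻ σ, ‖v σ‖ₑ ^ r ∂μ) := by
  have hr0 : 0 < r := hr.symm.pos
  have hr0' : 0 < r' := hr.pos
  have hr1 : 1 < r := hr.symm.lt
  have hm0 : μ Set.univ ≠ 0 := by simpa using hμ
  have hmt : μ Set.univ ≠ ⊤ := measure_ne_top _ _
  set a : ℝ≥0∞ := (μ Set.univ ^ (1 / r')) ^ r with ha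
  set b : ℝ≥0∞ := ‖ι‖ₑ ^ r / μ Set.univ with hb
  have hat : a < ⊤ := ENNReal.rpow_lt_top_of_nonneg hr0.le
    (ENNReal.rpow_ne_top_of_nonneg (by positivity) hmt)
  have hbt : b < ⊤ := ENNReal.div_lt_top (ENNReal.rpow_ne_top_of_nonneg hr0.le enorm_ne_top) hm0
  refine ⟨2 ^ (r - 1) * (a + b), ENNReal.mul_lt_top
    (ENNReal.rpow_lt_top_of_nonneg (by linarith) (by simp)) (ENNReal.add_lt_top.2 ⟨hat, hbt⟩), ?_⟩
  intro x v f h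
  set F := ∫⁻ σ, f σ ∂μ with hF
  have hFr : F ^ r ≤ a * ∫⁻ σ, f σ ^ r ∂μ := by
    calc F ^ r ≤ (μ Set.univ ^ (1 / r') * (∫⁻ σ, f σ ^ r ∂μ) ^ (1 / r)) ^ r := by
          gcongr
          exact lintegral_le_measure_rpow_mul hr f
      _ = _ := by
          rw [ENNReal.mul_rpow_of_nonneg _ _ hr0.le, ← ENNReal.rpow_mul _ (1 / r),
            one_div_mul_cancel hr0.ne', ENNReal.rpow_one]
  have hX : (‖x‖ₑ - F) ^ r ≤ b * ∫⁻ σ, ‖v σ‖ₑ ^ r ∂μ := by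
    have h1 := rpow_mul_measure_le_lintegral (μ := μ) MeasurableSet.univ hr0.le
      (X := ‖x‖ₑ - F) (c := ‖ι‖ₑ) enorm_ne_top (g := fun s => ‖v s‖ₑ) (by
        filter_upwards [h] with s hs _
        rw [tsub_le_iff_left]
        calc ‖x‖ₑ = ‖(x - ι (v s)) + ι (v s)‖ₑ := by rw [sub_add_cancel]
          _ ≤ ‖x - ι (v s)‖ₑ + ‖ι (v s)‖ₑ := enorm_add_le _ _
          _ ≤ _ := add_le_add hs (ι.le_opENorm _))
    rw [Measure.restrict_univ] at h1
    rw [hb, ENNReal.div_eq_inv_mul, mul_assoc, ← ENNReal.div_eq_inv_mul]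
    exact (ENNReal.le_div_iff_mul_le (Or.inl hm0) (Or.inl hmt)).2 h1
  calc ‖x‖ₑ ^ r ≤ (F + (‖x‖ₑ - F)) ^ r := by
        gcongr
        exact le_add_tsub
    _ ≤ 2 ^ (r - 1) * (F ^ r + (‖x‖ₑ - F) ^ r) :=
        ENNReal.rpow_add_le_mul_rpow_add_rpow _ _ hr1.le
    _ ≤ 2 ^ (r - 1) * ((a + b) * ∫⁻ σ, f σ ^ r ∂μ + (a + b) * ∫⁻ σ, ‖v σ‖ₑ ^ r ∂μ) := by
        gcongr
        · refine hFr.trans ?_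
          gcongr
          exact le_self_add
        · refine hX.trans ?_
          gcongr
          exact le_add_self
    _ = _ := by ring

theorem enorm_sub_le_lintegral_closedBall {T : ℝ} {u u' : ℝ → E₀}
    (hu : ∀ s ∈ Set.Icc 0 T, ∀ t ∈ Set.Icc 0 T, u t - u s = ∫ σ in s..t, u' σ)
    {s t : ℝ} (hs : s ∈ Set.Icc 0 T) (ht : t ∈ Set.Icc 0 T) :
    ‖u t - u s‖ₑ ≤
      ∫⁻ σ in Metric.closedBall t |s - t|, ‖u' σ‖ₑ ∂(volume.restrict (Set.Ioo 0 T)) := by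
  have h : ‖u t - u s‖ₑ = ‖∫ σ in Set.uIoc s t, u' σ‖ₑ := by
    rw [hu s hs t ht, ← ofReal_norm, ← ofReal_norm,
      intervalIntegral.norm_integral_eq_norm_integral_uIoc]
  rw [h, Measure.restrict_congr_set Ioo_ae_eq_Ioc,
    Measure.restrict_restrict Metric.isClosed_closedBall.measurableSet]
  refine (enorm_integral_le_lintegral_enorm _).trans (lintegral_mono_set fun σ hσ => ⟨?_, ?_⟩)
  · rw [Metric.mem_closedBall, Real.dist_eq, abs_sub_comm, abs_sub_comm s]
    exact Set.abs_sub_right_of_mem_uIcc (Set.uIoc_subset_uIcc hσ)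
  · exact ⟨(le_min hs.1 ht.1).trans_lt hσ.1, hσ.2.trans (max_le hs.2 ht.2)⟩

theorem tendsto_measure_closedBall_abs (μ : Measure ℝ) (hμ : μ ≤ volume) (t : ℝ) (S : Set ℝ) :
    Filter.Tendsto (fun s => μ (Metric.closedBall t |s - t|)) (nhdsWithin t S) (nhds 0) := by
  have h : Filter.Tendsto (fun s => ENNReal.ofReal (2 * |s - t|)) (nhdsWithin t S) (nhds 0) := by
    have hc : Continuous fun s : ℝ => ENNReal.ofReal (2 * |s - t|) :=
      ENNReal.continuous_ofReal.comp (by fun_prop)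
    simpa using (hc.tendsto t).mono_left nhdsWithin_le_nhds
  refine tendsto_of_tendsto_of_tendsto_of_le_of_le tendsto_const_nhds h
    (fun _ => zero_le) fun s => ?_
  exact (hμ _).trans_eq (Real.volume_closedBall _ _)

theorem eLpNorm_ofReal_eq_lintegral {α F : Type*} [MeasurableSpace α] [NormedAddCommGroup F]
    (μ : Measure α) {r : ℝ} (hr : 0 < r) (g : α → F) :
    eLpNorm g (ENNReal.ofReal r) μ = (∫⁻ σ, ‖g σ‖ₑ ^ r ∂μ) ^ (1 / r) := by
  rw [eLpNorm_eq_lintegral_rpow_enorm_toReal (by simpa using hr) (by simp),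
    ENNReal.toReal_ofReal hr.le]

theorem exists_two_zpow_lt {x : ℝ} (hx : 0 < x) : ∃ k : ℤ, (2 : ℝ) ^ k < x :=
  (exists_mem_Ioc_zpow hx one_lt_two).imp fun _ h => h.1

end MaximalRegularity

/-- Trace embedding for maximal regularity spaces (Amann; Lemma 2.5 of the paper, first
part): for Banach spaces `E₁ ↪ E₀` (continuous dense embedding `ι`) and `r ∈ (1,∞)`, the
maximal regularity space `W^{1,r}(I,E₀) ∩ L^r(I,E₁)` embeds continuously into
`C(Ī, (E₀,E₁)_{1/r',r})`, `1/r + 1/r' = 1`.  An element of the maximal regularity space is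
represented by `u : I → E₀` (an absolutely continuous representative, hypothesis `hAC`,
with derivative `u' ∈ L^r(I,E₀)`) taking values `u = ι ∘ u1` with `u1 ∈ L^r(I,E₁)`.
The conclusion: `u` takes values of finite `(E₀,E₁)_{1/r',r}`-norm, bounded by a constant
times the maximal regularity norm, and `t ↦ u(t)` is continuous on `Ī` with respect to the
`(E₀,E₁)_{1/r',r}`-norm. -/
theorem stmt_7 {E₀ E₁ : Type*}
    [NormedAddCommGroup E₀] [NormedSpace ℝ E₀] [CompleteSpace E₀]
    [NormedAddCommGroup E₁] [NormedSpace ℝ E₁] [CompleteSpace E₁]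
    (ι : E₁ →L[ℝ] E₀) (hιinj : Function.Injective ι) (hιdense : DenseRange ι)
    (T r r' : ℝ) (hT : 0 < T) (hr : 1 < r) (hr' : 1 / r + 1 / r' = 1) :
    ∃ C : ℝ≥0∞, C < ⊤ ∧
      ∀ (u u' : ℝ → E₀) (u1 : ℝ → E₁),
        (∀ t ∈ Set.Ioo 0 T, u t = ι (u1 t)) →
        (∀ s ∈ Set.Icc 0 T, ∀ t ∈ Set.Icc 0 T, u t - u s = ∫ σ in s..t, u' σ) →
        eLpNorm u' (ENNReal.ofReal r) (volume.restrict (Set.Ioo 0 T)) < ⊤ →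
        eLpNorm u1 (ENNReal.ofReal r) (volume.restrict (Set.Ioo 0 T)) < ⊤ →
        (∀ t ∈ Set.Icc 0 T,
          realInterpNorm ι (1 / r') r (u t)
            ≤ C * (eLpNorm u' (ENNReal.ofReal r) (volume.restrict (Set.Ioo 0 T))
                + eLpNorm u1 (ENNReal.ofReal r) (volume.restrict (Set.Ioo 0 T)))) ∧
        (∀ t ∈ Set.Icc 0 T,
          Filter.Tendsto (fun s => realInterpNorm ι (1 / r') r (u s - u t))
            (nhdsWithin t (Set.Icc 0 T)) (nhds 0)) := by
  have hpq : r'.HolderConjugate r :=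
    (Real.holderConjugate_iff.2 ⟨hr, by simpa only [one_div] using hr'⟩).symm
  have hr0 : 0 < r := by linarith
  set μ := volume.restrict (Set.Ioo 0 T) with hμ
  have hμ0 : μ ≠ 0 := by
    rw [hμ, Ne, Measure.restrict_eq_zero, Real.volume_Ioo]
    simpa using hT
  obtain ⟨Cs, hCs, hsmall⟩ := exists_tsum_interpTerm_le_lintegral ι hpq
  obtain ⟨Cn, hCn, hEnorm⟩ := exists_enorm_rpow_le_lintegral ι μ hμ0 hpq
  obtain ⟨k₀, hk₀⟩ := exists_two_zpow_lt (half_pos hT)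
  obtain ⟨Cl, hCl, hlarge⟩ := exists_tsum_interpTerm_le ι hr0 (one_div_pos.2 hpq.pos) k₀
  refine ⟨(Cl * Cn + Cs) ^ (1 / r), ENNReal.rpow_lt_top_of_nonneg (by positivity)
    (ENNReal.add_lt_top.2 ⟨ENNReal.mul_lt_top hCl hCn, hCs⟩).ne, ?_⟩
  intro u u' u1 huι hu hu' hu1
  simp only [eLpNorm_ofReal_eq_lintegral _ hr0] at hu' hu1 ⊢
  set U := ∫⁻ σ, ‖u' σ‖ₑ ^ r ∂μ with hU
  set G := ∫⁻ σ, ‖u1 σ‖ₑ ^ r ∂μ with hG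
  have hUt : U ≠ ⊤ := fun h => by simp [h, hr0] at hu'
  have hGt : G ≠ ⊤ := fun h => by simp [h, hr0] at hu1
  have hball : ∀ t ∈ Set.Icc 0 T, ∀ s ∈ Set.Ioo 0 T, ‖u t - ι (u1 s)‖ₑ ≤
      ∫⁻ σ in Metric.closedBall t |s - t|, ‖u' σ‖ₑ ∂μ := fun t ht s hs => by
    rw [← huι s hs]
    exact enorm_sub_le_lintegral_closedBall hu (Set.Ioo_subset_Icc_self hs) ht
  constructor
  · intro t ht
    rw [← ENNReal.rpow_le_rpow_iff hr0, realInterpNorm_rpow ι hr0 _ _ k₀,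
      ENNReal.mul_rpow_of_nonneg _ _ hr0.le, ← ENNReal.rpow_mul, one_div_mul_cancel hr0.ne',
      ENNReal.rpow_one]
    have hUG : U + G ≤ (U ^ (1 / r) + G ^ (1 / r)) ^ r := by
      refine le_trans (le_of_eq ?_) (ENNReal.add_rpow_le_rpow_add _ _ hr.le)
      simp_rw [← ENNReal.rpow_mul, one_div_mul_cancel hr0.ne', ENNReal.rpow_one]
    calc _ ≤ Cl * ‖u t‖ₑ ^ r + Cs * (U + G) := by
          refine add_le_add (hlarge _) ((hsmall T t ht k₀ hk₀ (u t) u1 _ (hball t ht)).trans ?_)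
          gcongr <;> exact setLIntegral_le_lintegral _ _
      _ ≤ Cl * (Cn * (U + G)) + Cs * (U + G) := by
          gcongr
          refine hEnorm (u t) u1 (fun σ => ‖u' σ‖ₑ) ?_
          filter_upwards [ae_restrict_mem measurableSet_Ioo] with s hs
          exact (hball t ht s hs).trans (setLIntegral_le_lintegral _ _)
      _ = (Cl * Cn + Cs) * (U + G) := by ring
      _ ≤ _ := by gcongr
  · intro t ht
    have hpow : Filter.Tendsto (fun s => realInterpNorm ι (1 / r') r (u s - u t) ^ r)
        (nhdsWithin t (Set.Icc 0 T)) (nhds 0) := by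
      rw [ENNReal.tendsto_nhds_zero]
      intro ε hε
      have hε2 : ε / 2 ≠ 0 := (ENNReal.half_pos hε.ne').ne'
      set M : ℝ≥0∞ := 2 ^ (r - 1) * (4 * Cs) with hM
      have hMt : M ≠ ⊤ := (ENNReal.mul_lt_top
        (ENNReal.rpow_lt_top_of_nonneg (by linarith) (by simp))
        (ENNReal.mul_lt_top (by simp) hCs)).ne
      set η := ε / 2 / M with hη
      have hη0 : η ≠ 0 := ENNReal.div_ne_zero.2 ⟨hε2, hMt⟩
      obtain ⟨δ₁, hδ₁, hsm₁⟩ := exists_pos_setLIntegral_lt_of_measure_lt hUt hη0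
      obtain ⟨δ₂, hδ₂, hsm₂⟩ := exists_pos_setLIntegral_lt_of_measure_lt hGt hη0
      set δ : ℝ≥0∞ := min (min δ₁ δ₂) 1 with hδ
      have hδ0 : 0 < δ := lt_min (lt_min hδ₁ hδ₂) one_pos
      have hδt : δ ≠ ⊤ := ((min_le_right _ _).trans_lt ENNReal.one_lt_top).ne
      obtain ⟨k, hk⟩ := exists_two_zpow_lt
        (lt_min (half_pos hT) (half_pos (ENNReal.toReal_pos hδ0.ne' hδt)))
      have hμball (s : ℝ) : μ (Metric.closedBall s (2 ^ k)) < δ := by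
        refine (Measure.restrict_apply_le _ _).trans_lt ?_
        rw [Real.volume_closedBall, ENNReal.ofReal_lt_iff_lt_toReal (by positivity) hδt]
        linarith [hk.trans_le (min_le_right _ _)]
      obtain ⟨Cl', hCl', hlarge'⟩ := exists_tsum_interpTerm_le ι hr0 (one_div_pos.2 hpq.pos) k
      have htail (s : ℝ) (hs : s ∈ Set.Icc 0 T) :
          ∑' n : ℕ, interpTerm ι (1 / r') r (u s) (k - (n + 1)) ≤ Cs * (η + η) := by
        refine (hsmall T s hs k (hk.trans_le (min_le_left _ _)) (u s) u1 _ (hball s hs)).trans ?_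
        gcongr
        · exact (hsm₁ _ ((hμball s).trans_le ((min_le_left _ _).trans (min_le_left _ _)))).le
        · exact (hsm₂ _ ((hμball s).trans_le ((min_le_left _ _).trans (min_le_right _ _)))).le
      have hu'1 : ∫⁻ σ, ‖u' σ‖ₑ ∂μ ≠ ⊤ := by
        refine ((lintegral_le_measure_rpow_mul hpq _).trans_lt (ENNReal.mul_lt_top ?_ hu')).ne
        exact ENNReal.rpow_lt_top_of_nonneg (one_div_pos.2 hpq.pos).le (measure_ne_top _ _)
      have hcont : Filter.Tendsto (fun s => Cl' *
          (∫⁻ σ in Metric.closedBall t |s - t|, ‖u' σ‖ₑ ∂μ) ^ r)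
          (nhdsWithin t (Set.Icc 0 T)) (nhds 0) := by
        have h := tendsto_setLIntegral_zero hu'1
          (tendsto_measure_closedBall_abs μ Measure.restrict_le_self t (Set.Icc 0 T))
        have h' := ENNReal.Tendsto.const_mul (a := Cl')
          ((ENNReal.continuous_rpow_const (y := r)).tendsto 0 |>.comp h) (Or.inr hCl'.ne)
        simpa [hr0] using h'
      filter_upwards [ENNReal.tendsto_nhds_zero.1 hcont (ε / 2) (pos_iff_ne_zero.2 hε2),
        self_mem_nhdsWithin] with s hs1 hs
      rw [realInterpNorm_rpow ι hr0 _ _ k, ← ENNReal.add_halves ε]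
      refine add_le_add ((hlarge' _).trans (le_trans ?_ hs1)) ?_
      · gcongr
        rw [enorm_sub_rev]
        exact enorm_sub_le_lintegral_closedBall hu hs ht
      · calc ∑' n : ℕ, interpTerm ι (1 / r') r (u s - u t) (k - (n + 1))
            ≤ ∑' n : ℕ, 2 ^ (r - 1) * (interpTerm ι (1 / r') r (u s) (k - (n + 1)) +
                interpTerm ι (1 / r') r (u t) (k - (n + 1))) :=
              ENNReal.tsum_le_tsum fun n => interpTerm_sub_le ι hr.le _ _ _ _
          _ ≤ 2 ^ (r - 1) * (Cs * (η + η) + Cs * (η + η)) := by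
              rw [ENNReal.tsum_mul_left, ENNReal.tsum_add]
              gcongr
              · exact htail s hs
              · exact htail t ht
          _ = M * η := by rw [hM]; ring
          _ ≤ ε / 2 := ENNReal.mul_div_le
    have h := (ENNReal.continuous_rpow_const (y := 1 / r)).tendsto 0 |>.comp hpow
    simpa [Function.comp_def, ← ENNReal.rpow_mul, mul_inv_cancel₀ hr0.ne', hr0] using h

end
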